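/- For every 6-element subset S ⊆ {1, …, 8}, the polynomial function t ↦ det N_S(t), where N_S(t) is the 6×6 complex matrix whose row indexed by i ∈ S is (x_i², y_i², z_i², x_i y_i, x_i z_i, y_i z_i) with (x_i, y_i, z_i) = σ_i(t), is not identically zero on ℂ; equivalently, for each 6-element subset S the set of t ∈ ℂ for which some nonzero homogeneous polynomial of degree 2 in three variables vanishes at σ_i(t) for all i ∈ S is finite. -/

import Mathlib

open Matrix

/-- The eight families of points `σ₁(t), …, σ₈(t)` in `ℂ³` from the proof of
Proposition (prop;def_to_toric). -/
noncomputable def sigmaPts (i : Fin 8) (t : ℂ) : Fin 3 → ℂ :=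
  ![![1, t ^ 5, 0],
    ![t ^ 5, 1, 0],
    ![0, 0, 1],
    ![1, t ^ 2, t],
    ![t ^ 2, 1, t],
    ![t, t ^ 2, 1],
    ![1, t ^ 3, 2 * t],
    ![t ^ 4, 1, 2 * t]] i

/-- The vector `(x², y², z², xy, xz, yz)` of degree-2 monomials evaluated at
`v = (x, y, z) ∈ ℂ³`. -/
noncomputable def mon2 (v : Fin 3 → ℂ) : Fin 6 → ℂ :=
  ![v 0 ^ 2, v 1 ^ 2, v 2 ^ 2, v 0 * v 1, v 0 * v 2, v 1 * v 2]

open Polynomial in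
/-- The monomial matrix over `ℤ[X]`. -/
noncomputable def polyMat : Matrix (Fin 8) (Fin 6) ℤ[X] :=
  !![1, X ^ 10, 0, X ^ 5, 0, 0;
     X ^ 10, 1, 0, X ^ 5, 0, 0;
     0, 0, 1, 0, 0, 0;
     1, X ^ 4, X ^ 2, X ^ 2, X, X ^ 3;
     X ^ 4, 1, X ^ 2, X ^ 2, X ^ 3, X;
     X ^ 2, X ^ 4, 1, X ^ 3, X, X ^ 2;
     1, X ^ 6, 4 * X ^ 2, X ^ 3, 2 * X, 2 * X ^ 4;
     X ^ 8, 1, 4 * X ^ 2, X ^ 4, 2 * X ^ 5, 2 * X]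

/-- Its specialization at `X = 11` modulo 13. -/
def modMat : Matrix (Fin 8) (Fin 6) (ZMod 13) :=
  !![1, 10, 0, 7, 0, 0;
     10, 1, 0, 7, 0, 0;
     0, 0, 1, 0, 0, 0;
     1, 3, 4, 4, 11, 5;
     3, 1, 4, 4, 5, 11;
     4, 3, 1, 5, 11, 4;
     1, 12, 3, 5, 9, 6;
     9, 1, 3, 3, 1, 9]

/-- Inverse of the first six rows of `modMat`, padded with zero columns. -/
def invMat : Matrix (Fin 6) (Fin 8) (ZMod 13) :=
  !![9, 10, 9, 10, 2, 8, 0, 0;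
     12, 7, 9, 10, 2, 8, 0, 0;
     0, 0, 1, 0, 0, 0, 0, 0;
     4, 9, 10, 1, 8, 6, 0, 0;
     4, 1, 8, 4, 3, 3, 0, 0;
     5, 0, 8, 6, 1, 3, 0, 0]

/-- First basis vector of the left kernel of `modMat`. -/
def kerP : Fin 8 → ZMod 13 := ![8, 8, 9, 1, 5, 3, 1, 0]

/-- Second basis vector of the left kernel of `modMat`. -/
def kerQ : Fin 8 → ZMod 13 := ![2, 5, 5, 8, 9, 2, 0, 1]

instance fact_prime_thirteen : Fact (Nat.Prime 13) := ⟨by norm_num⟩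

set_option maxRecDepth 100000 in
lemma modMat_mul_invMat (k j : Fin 8) : ∑ c, modMat k c * invMat c j =
    (if k = j then 1 else 0) - (if k = 6 then kerP j else 0) - (if k = 7 then kerQ j else 0) := by
  revert k j; decide

set_option maxRecDepth 100000 in
lemma ker_minor (j k : Fin 8) (h : j ≠ k) : kerP j * kerQ k - kerP k * kerQ j ≠ 0 := by
  revert j k; decide

lemma left_kernel (w : Fin 8 → ZMod 13) (hw : ∀ c, ∑ k, w k * modMat k c = 0) (j : Fin 8) :
    w j = w 6 * kerP j + w 7 * kerQ j := by
  have h : ∑ k, w k * ∑ c, modMat k c * invMat c j = 0 := by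
    simp_rw [Finset.mul_sum]
    rw [Finset.sum_comm]
    simp_rw [← mul_assoc, ← Finset.sum_mul, hw]
    simp
  simp_rw [modMat_mul_invMat, mul_sub, mul_ite, mul_one, mul_zero, Finset.sum_sub_distrib] at h
  simp at h
  linear_combination h

lemma modMat_det_ne_zero (f : Fin 6 → Fin 8) (hf : Function.Injective f) :
    (Matrix.of fun i : Fin 6 => modMat (f i)).det ≠ 0 := by
  intro hdet
  obtain ⟨w, hw0, hw⟩ := Matrix.exists_vecMul_eq_zero_iff.mpr hdet
  set w' : Fin 8 → ZMod 13 := fun j => ∑ i, if f i = j then w i else 0 with hw'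
  have hker : ∀ c, ∑ k, w' k * modMat k c = 0 := by
    intro c
    have h1 := congrFun hw c
    simp only [Matrix.vecMul, dotProduct, Matrix.of_apply, Pi.zero_apply] at h1
    simp only [hw', Finset.sum_mul]
    rw [Finset.sum_comm]
    simpa [ite_mul] using h1
  have hrep := left_kernel w' hker
  have hval : ∀ i, w' (f i) = w i := by
    intro i
    simp [hw', hf.eq_iff]
  have hout : ∀ j, (∀ i, f i ≠ j) → w' j = 0 := by
    intro j hj
    simp [hw', hj]
  have hcard : 1 < ((Finset.univ.image f)ᶜ).card := by
    rw [Finset.card_compl, Finset.card_image_of_injective _ hf]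
    simp
  obtain ⟨j, hj, k, hk, hjk⟩ := Finset.one_lt_card.mp hcard
  have ej := (hrep j).symm.trans (hout j (by simpa using hj))
  have ek := (hrep k).symm.trans (hout k (by simpa using hk))
  have hm := ker_minor j k hjk
  have h6 : w' 6 = 0 := by
    refine (mul_eq_zero.mp ?_).resolve_right hm
    linear_combination kerQ k * ej - kerQ j * ek
  have h7 : w' 7 = 0 := by
    refine (mul_eq_zero.mp ?_).resolve_right hm
    linear_combination kerP j * ek - kerP k * ej
  apply hw0
  funext i
  rw [← hval i, hrep, h6, h7]
  simp

open Polynomial in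
lemma polyMat_mod (i : Fin 8) (c : Fin 6) :
    (Polynomial.eval₂RingHom (Int.castRingHom (ZMod 13)) 11) (polyMat i c) = modMat i c := by
  fin_cases i <;> fin_cases c <;> simp [polyMat, modMat] <;> decide

lemma polyMat_complex (t : ℂ) (i : Fin 8) (c : Fin 6) :
    (Polynomial.eval₂RingHom (Int.castRingHom ℂ) t) (polyMat i c) = mon2 (sigmaPts i t) c := by
  fin_cases i <;> fin_cases c <;> simp [polyMat, mon2, sigmaPts] <;> ring

lemma polyMat_det_ne_zero (f : Fin 6 → Fin 8) (hf : Function.Injective f) :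
    (Matrix.of fun i : Fin 6 => polyMat (f i)).det ≠ 0 := by
  intro h
  apply modMat_det_ne_zero f hf
  have h2 := congrArg (Polynomial.eval₂RingHom (Int.castRingHom (ZMod 13)) 11) h
  rw [RingHom.map_det, map_zero] at h2
  rw [← h2]
  refine congrArg Matrix.det ?_
  ext i c
  exact (polyMat_mod (f i) c).symm

/-- For every 6-element subset `S ⊆ {1, …, 8}` (encoded by an injection `Fin 6 ↪ Fin 8`),
the polynomial function `t ↦ det N_S(t)`, where the row of `N_S(t)` indexed by `i ∈ S` is
the vector of degree-2 monomials evaluated at `σᵢ(t)`, is not identically zero on `ℂ`;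
equivalently, the set of `t` for which the six points `σᵢ(t)`, `i ∈ S`, lie on a common
conic is finite. -/
theorem sigma_six_conic_det_not_identically_zero
    (f : Fin 6 → Fin 8) (hf : Function.Injective f) :
    {t : ℂ | (Matrix.of fun i : Fin 6 => mon2 (sigmaPts (f i) t)).det = 0}.Finite := by
  have hne := polyMat_det_ne_zero f hf
  set D := (Matrix.of fun i : Fin 6 => polyMat (f i)).det with hD
  have hne' : D.map (Int.castRingHom ℂ) ≠ 0 :=
    (Polynomial.map_ne_zero_iff (RingHom.injective_int _)).mpr hne
  refine (Polynomial.finite_setOfPred_isRoot hne').subset ?_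
  intro t ht
  have h2 : Polynomial.eval₂RingHom (Int.castRingHom ℂ) t D = 0 := by
    rw [hD, RingHom.map_det]
    rw [← (show _ = _ from ht)]
    refine congrArg Matrix.det ?_
    ext i c
    exact polyMat_complex t (f i) c
  simpa [Polynomial.IsRoot, Polynomial.eval_map] using h2
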